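/- Let H be a complex inner product space, c : H → H a unitary linear map with c² = −1 (so c is anti-self-adjoint), and χ : H → H a self-adjoint involution (χ² = 1, χ* = χ) which anti-commutes with c (χ ∘ c = −c ∘ χ). Let L = {u ∈ H : χ(u) = u} be the +1-eigenspace of χ. Then c maps L onto the orthogonal complement of L, i.e. c(L) = L^⊥. -/

import Mathlib

open scoped ComplexInnerProductSpace

theorem stmt_9 {H : Type*} [NormedAddCommGroup H] [InnerProductSpace ℂ H]
    [FiniteDimensional ℂ H] (c χ : H →ₗ[ℂ] H)
    (hcu : ∀ u v : H, ⟪c u, c v⟫ = ⟪u, v⟫)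
    (hc2 : ∀ u, c (c u) = -u)
    (hχ2 : ∀ u, χ (χ u) = u)
    (hχsa : ∀ u v : H, ⟪χ u, v⟫ = ⟪u, χ v⟫)
    (hanti : ∀ u, χ (c u) = -c (χ u)) :
    c '' {u | χ u = u} = {v | ∀ u, χ u = u → ⟪u, v⟫ = 0} := by
  ext v
  simp only [Set.mem_image, Set.mem_setOf_eq]
  constructor
  · rintro ⟨w, hw, rfl⟩ u hu
    have h := hχsa u (c w)
    rw [hu, hanti, hw, inner_neg_right] at h
    exact self_eq_neg.mp h
  · intro hv
    have hw : χ (v + χ v) = v + χ v := by rw [map_add, hχ2, add_comm]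
    have h1 := hv _ hw
    have h2 := hχsa (v + χ v) v
    rw [hw, h1] at h2
    have h0 : v + χ v = 0 := by
      rw [← inner_self_eq_zero (𝕜 := ℂ), inner_add_right, h1, ← h2, add_zero]
    have hneg : χ v = -v := (neg_eq_of_add_eq_zero_right h0).symm
    refine ⟨-c v, ?_, ?_⟩
    · rw [map_neg, hanti, hneg, map_neg, neg_neg]
    · rw [map_neg, hc2, neg_neg]
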